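/- arXiv:math/0106022 — 3 statements merged into one kernel-verified Lean document; each statement's English description precedes it below -/
import Mathlib

section
/- Let G be a finite simple graph with maximum vertex degree at most K, let A and B be sets of vertices, let l ≥ 1, and suppose that at least M vertices a ∈ A admit a path of length at most l from a to B. Then there exist at least M / (2·(l+1)²·K^l) pairwise vertex-disjoint paths of length at most l from A to B. -/
open scoped Classical

theorem sphere_card_le {V : Type*} [Fintype V] [DecidableEq V]
    (G : SimpleGraph V) (K : ℕ) (hdeg : ∀ v : V, G.degree v ≤ K) (i : ℕ) :
    ∀ u : V, (Finset.univ.filter (fun a => ∃ w : G.Walk u a, w.length = i)).card ≤ K ^ i := by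
  induction i with
  | zero =>
    intro u
    rw [pow_zero, Finset.card_le_one]
    intro a ha b hb
    simp only [Finset.mem_filter, Finset.mem_univ, true_and] at ha hb
    obtain ⟨w, hw⟩ := ha
    obtain ⟨w', hw'⟩ := hb
    rw [← SimpleGraph.Walk.eq_of_length_eq_zero hw, ← SimpleGraph.Walk.eq_of_length_eq_zero hw']
  | succ i ih =>
    intro u
    have hsub : (Finset.univ.filter (fun a => ∃ w : G.Walk u a, w.length = i + 1)) ⊆
        (G.neighborFinset u).biUnion
          (fun v => Finset.univ.filter (fun a => ∃ w : G.Walk v a, w.length = i)) := by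
      intro a ha
      simp only [Finset.mem_filter, Finset.mem_univ, true_and] at ha
      obtain ⟨w, hw⟩ := ha
      cases w with
      | nil => simp at hw
      | @cons _ v _ h p =>
        simp only [Finset.mem_biUnion, Finset.mem_filter, Finset.mem_univ, true_and,
          SimpleGraph.mem_neighborFinset]
        refine ⟨v, h, p, ?_⟩
        simpa using hw
    refine (Finset.card_le_card hsub).trans ?_
    refine (Finset.card_biUnion_le_card_mul _ _ (K ^ i) (fun v _ => ih v)).trans ?_
    rw [pow_succ, mul_comm, SimpleGraph.card_neighborFinset_eq_degree]
    exact Nat.mul_le_mul_left _ (hdeg u)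

theorem ball_card_le {V : Type*} [Fintype V] [DecidableEq V]
    (G : SimpleGraph V) (K l : ℕ) (hK : 1 ≤ K) (hdeg : ∀ v : V, G.degree v ≤ K) (u : V) :
    (Finset.univ.filter (fun a => ∃ w : G.Walk u a, w.length ≤ l)).card ≤ (l + 1) * K ^ l := by
  have hsub : (Finset.univ.filter (fun a => ∃ w : G.Walk u a, w.length ≤ l)) ⊆
      (Finset.range (l + 1)).biUnion
        (fun i => Finset.univ.filter (fun a => ∃ w : G.Walk u a, w.length = i)) := by
    intro a ha
    simp only [Finset.mem_filter, Finset.mem_univ, true_and] at ha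
    obtain ⟨w, hw⟩ := ha
    simp only [Finset.mem_biUnion, Finset.mem_filter, Finset.mem_univ, true_and, Finset.mem_range]
    exact ⟨w.length, by omega, w, rfl⟩
  refine (Finset.card_le_card hsub).trans ?_
  refine (Finset.card_biUnion_le_card_mul _ _ (K ^ l) ?_).trans (by simp)
  intro i hi
  rw [Finset.mem_range] at hi
  exact (sphere_card_le G K hdeg i u).trans (Nat.pow_le_pow_right hK (by omega))

theorem disjoint_paths_from_many_short_paths
    {V : Type*} [Fintype V] [DecidableEq V]
    (G : SimpleGraph V) (K l M : ℕ) (hl : 1 ≤ l)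
    (hdeg : ∀ v : V, G.degree v ≤ K)
    (A B : Set V)
    (hM : M ≤ Set.ncard {a ∈ A | ∃ b ∈ B, ∃ w : G.Walk a b, w.IsPath ∧ w.length ≤ l}) :
    ∃ Ps : Finset ((u : V) × (w : V) × G.Walk u w),
      (M : ℝ) / (2 * (l + 1) ^ 2 * K ^ l) ≤ (Ps.card : ℝ) ∧
      (∀ P ∈ Ps, P.2.2.IsPath ∧ P.2.2.length ≤ l ∧ P.1 ∈ A ∧ P.2.1 ∈ B) ∧
      (∀ P ∈ Ps, ∀ Q ∈ Ps, P ≠ Q → ∀ x ∈ P.2.2.support, x ∉ Q.2.2.support) := by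
  rcases Nat.eq_zero_or_pos K with hK | hK
  · refine ⟨∅, ?_, by simp, by simp⟩
    have : l ≠ 0 := by omega
    simp [hK, this]
  set g : Set V := {a ∈ A | ∃ b ∈ B, ∃ w : G.Walk a b, w.IsPath ∧ w.length ≤ l} with hg
  have hex : ∀ a : V, ∃ P : (w : V) × G.Walk a w,
      a ∈ g → P.2.IsPath ∧ P.2.length ≤ l ∧ a ∈ A ∧ P.1 ∈ B := by
    intro a
    by_cases ha : a ∈ g
    · obtain ⟨hA, b, hb, w, hw, hwl⟩ := ha
      exact ⟨⟨b, w⟩, fun _ => ⟨hw, hwl, hA, hb⟩⟩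
    · exact ⟨⟨a, SimpleGraph.Walk.nil⟩, fun h => absurd h ha⟩
  choose p hp using hex
  let good : Finset V → Prop := fun S => (∀ a ∈ S, a ∈ g) ∧
    ∀ a ∈ S, ∀ b ∈ S, a ≠ b → ∀ x ∈ (p a).2.support, x ∉ (p b).2.support
  obtain ⟨S, hS, hmax⟩ := Finset.exists_max_image (Finset.univ.filter good) Finset.card
    ⟨∅, by simp [good]⟩
  have hS' : good S := by simpa using hS
  obtain ⟨hSg, hSd⟩ := hS'
  have hit : ∀ a ∈ g, ∃ s ∈ S, ∃ x ∈ (p s).2.support, x ∈ (p a).2.support := by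
    intro a ha
    by_cases haS : a ∈ S
    · exact ⟨a, haS, a, SimpleGraph.Walk.start_mem_support _, SimpleGraph.Walk.start_mem_support _⟩
    by_contra! hno
    have hgood : good (insert a S) := by
      refine ⟨?_, ?_⟩
      · intro b hb
        rcases Finset.mem_insert.1 hb with rfl | hb2
        · exact ha
        · exact hSg b hb2
      · intro b hb c hc hbc x hx hx'
        rcases Finset.mem_insert.1 hb with rfl | hb2
        · rcases Finset.mem_insert.1 hc with rfl | hc
          · exact hbc rfl
          · exact hno c hc x hx' hx
        · rcases Finset.mem_insert.1 hc with rfl | hc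
          · exact hno b hb2 x hx hx'
          · exact hSd b hb2 c hc hbc x hx hx'
    have := hmax (insert a S) (by simpa using hgood)
    rw [Finset.card_insert_of_notMem haS] at this
    omega
  have hcount : M ≤ S.card * ((l + 1) * ((l + 1) * K ^ l)) := by
    have hsub : g ⊆ ((S.biUnion (fun s => (p s).2.support.toFinset.biUnion
        (fun x => Finset.univ.filter (fun a => ∃ w : G.Walk x a, w.length ≤ l))) : Finset V) :
          Set V) := by
      intro a ha
      obtain ⟨s, hs, x, hx, hxa⟩ := hit a ha
      simp only [Finset.coe_biUnion, Set.mem_iUnion, Finset.mem_coe, Finset.mem_filter,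
        Finset.mem_univ, true_and, List.mem_toFinset]
      refine ⟨s, hs, x, hx, ((p a).2.takeUntil x hxa).reverse, ?_⟩
      rw [SimpleGraph.Walk.length_reverse]
      exact ((p a).2.length_takeUntil_le_length hxa).trans (hp a ha).2.1
    have h1 := Set.ncard_le_ncard hsub (Finset.finite_toSet _)
    rw [Set.ncard_coe_finset] at h1
    refine (hM.trans h1).trans ?_
    refine Finset.card_biUnion_le_card_mul _ _ _ ?_
    intro s hs
    refine (Finset.card_biUnion_le_card_mul _ _ _
      (fun x _ => ball_card_le G K l hK hdeg x)).trans ?_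
    refine Nat.mul_le_mul_right _ ((List.toFinset_card_le _).trans ?_)
    rw [SimpleGraph.Walk.length_support]
    have := (hp s (hSg s hs)).2.1
    omega
  refine ⟨S.image (fun a => ⟨a, p a⟩), ?_, ?_, ?_⟩
  · rw [Finset.card_image_of_injective _ (fun a b h => congrArg Sigma.fst h)]
    have hKr : (0 : ℝ) < K := by exact_mod_cast hK
    rw [div_le_iff₀ (by positivity)]
    have h2 : (M : ℝ) ≤ S.card * ((l + 1) * ((l + 1) * K ^ l)) := by exact_mod_cast hcount
    have h3 : (0 : ℝ) ≤ S.card * ((l + 1) * ((l + 1) * K ^ l)) := by positivity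
    linarith
  · intro P hP
    obtain ⟨a, ha, rfl⟩ := Finset.mem_image.1 hP
    exact hp a (hSg a ha)
  · intro P hP Q hQ hPQ
    obtain ⟨a, ha, rfl⟩ := Finset.mem_image.1 hP
    obtain ⟨b, hb, rfl⟩ := Finset.mem_image.1 hQ
    exact hSd a ha b hb (fun h => hPQ (by rw [h]))
end

section
/- Let Γ be a finite group and let S ⊆ Γ be a symmetric generating set (S = S⁻¹ and S generates Γ). Then every element of Γ can be written as a product of at most 3·|Γ|/|S| elements of S. Equivalently, if a₁a₂⋯a_l (with all a_i ∈ S) is a shortest word in the generators S representing its element of Γ, then l ≤ 3·|Γ|/|S|. -/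
theorem short_words_in_symmetric_generating_set
    {Γ : Type*} [Group Γ] [Fintype Γ] [DecidableEq Γ]
    (S : Finset Γ) (hsym : ∀ s ∈ S, s⁻¹ ∈ S)
    (hgen : Subgroup.closure (S : Set Γ) = ⊤) :
    ∀ g : Γ, ∃ L : List Γ, (∀ x ∈ L, x ∈ S) ∧ L.prod = g ∧
      (L.length : ℝ) ≤ 3 * Fintype.card Γ / S.card := by
  classical
  intro g
  have hex : ∃ n : ℕ, ∃ L : List Γ, (∀ x ∈ L, x ∈ S) ∧ L.prod = g ∧ L.length = n := by
    have hg : g ∈ Subgroup.closure (S : Set Γ) := by rw [hgen]; trivial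
    rw [← Subgroup.mem_toSubmonoid, Subgroup.closure_toSubmonoid] at hg
    obtain ⟨L, hL, hp⟩ := Submonoid.exists_list_of_mem_closure hg
    refine ⟨L.length, L, fun x hx => ?_, hp, rfl⟩
    rcases hL x hx with h | h
    · exact h
    · simpa using hsym _ h
  obtain ⟨L, hL, hp, hlen⟩ := Nat.find_spec hex
  have hmin : ∀ M : List Γ, (∀ x ∈ M, x ∈ S) → M.prod = g → L.length ≤ M.length := by
    intro M hM hMp
    rw [hlen]
    exact Nat.find_min' hex ⟨M, hM, hMp, rfl⟩
  refine ⟨L, hL, hp, ?_⟩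
  have key : ∀ i j : ℕ, i < j → 3 * j ≤ L.length → ∀ s ∈ S, ∀ t ∈ S,
      (L.take (3 * i)).prod * s ≠ (L.take (3 * j)).prod * t := by
    intro i j hij hj s hs t ht heq
    have h := hmin (L.take (3 * i) ++ ([s, t⁻¹] ++ L.drop (3 * j))) ?_ ?_
    · simp only [List.length_append, List.length_take, List.length_drop, List.length_cons,
        List.length_nil] at h
      omega
    · intro x hx
      simp only [List.mem_append, List.mem_cons, List.not_mem_nil, or_false] at hx
      rcases hx with h | (h | h) | h
      · exact hL x (List.mem_of_mem_take h)
      · exact h ▸ hs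
      · exact h ▸ hsym t ht
      · exact hL x (List.mem_of_mem_drop h)
    · have h2 : (L.take (3 * i)).prod * s * t⁻¹ = (L.take (3 * j)).prod := by
        rw [heq]; group
      rw [List.prod_append, List.prod_append]
      simp only [List.prod_cons, List.prod_nil, mul_one]
      rw [← mul_assoc, ← mul_assoc, h2, List.prod_take_mul_prod_drop, hp]
  have hinj : Function.Injective
      (fun p : Fin (L.length / 3 + 1) × S => (L.take (3 * (p.1 : ℕ))).prod * (p.2 : Γ)) := by
    rintro ⟨i, s, hs⟩ ⟨j, t, ht⟩ h
    simp only at h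
    rcases lt_trichotomy (i : ℕ) (j : ℕ) with hij | hij | hij
    · exact absurd h (key i j hij (by omega) s hs t ht)
    · have hij' : i = j := Fin.ext hij
      subst hij'
      have := mul_left_cancel h
      subst this
      rfl
    · exact absurd h.symm (key j i hij (by omega) t ht s hs)
  have hcard := Fintype.card_le_of_injective _ hinj
  simp only [Fintype.card_prod, Fintype.card_fin, Fintype.card_coe] at hcard
  rcases Nat.eq_zero_or_pos S.card with h0 | hpos
  · have : L = [] := by
      rw [Finset.card_eq_zero] at h0
      subst h0
      exact List.eq_nil_iff_forall_not_mem.2 fun x hx => by simpa using hL x hx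
    simp [this, h0]
  · rw [le_div_iff₀ (by exact_mod_cast hpos)]
    have h3 : L.length ≤ 3 * (L.length / 3 + 1) := by omega
    have h4 : L.length * S.card ≤ 3 * Fintype.card Γ := by
      calc L.length * S.card ≤ 3 * (L.length / 3 + 1) * S.card := Nat.mul_le_mul_right _ h3
        _ = 3 * ((L.length / 3 + 1) * S.card) := by ring
        _ ≤ _ := Nat.mul_le_mul_left _ hcard
    exact_mod_cast h4
end

section
/- Let G be a finite connected vertex-transitive simple graph on at least two vertices. Then the Cheeger constant of G satisfies h(G) ≥ 1/diam(G), where h(G) = min{ |∂S| / |S| : S ⊆ V(G), 1 ≤ |S| ≤ |V(G)|/2 } and ∂S denotes the set of edges of G with exactly one endpoint in S. -/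
open scoped Classical

/-- The edge boundary of a vertex set `S`: the edges of `G` with exactly one
endpoint in `S`. -/
noncomputable def edgeBoundary {V : Type*} [Fintype V] [DecidableEq V]
    (G : SimpleGraph V) (S : Finset V) : Finset (Sym2 V) :=
  G.edgeFinset.filter (fun e => ∃ u v : V, e = s(u, v) ∧ u ∈ S ∧ v ∉ S)


namespace CheegerAux

open SimpleGraph

variable {V : Type*} [Fintype V] [DecidableEq V] (G : SimpleGraph V)

noncomputable instance autFintype : Fintype (G ≃g G) :=
  @Fintype.ofFinite _ (Finite.of_injective (fun f : G ≃g G => f.toEquiv)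
    (fun _ _ h => RelIso.toEquiv_injective h))

/-- number of automorphisms taking `z` to `x` -/
noncomputable def tcount (z x : V) : ℕ := (Finset.univ.filter (fun γ : G ≃g G => γ z = x)).card

/-- number of automorphisms taking the edge `e` to `f` -/
noncomputable def wcount (f e : Sym2 V) : ℕ :=
  (Finset.univ.filter (fun γ : G ≃g G => e.map γ = f)).card

variable {G}

lemma tcount_right (δ : G ≃g G) (z x : V) : tcount G z x = tcount G z (δ x) := by
  unfold tcount
  refine Finset.card_bij (fun γ _ => γ.trans δ) ?_ ?_ ?_
  · intro γ h; simp at h ⊢; exact h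
  · intro a _ b _ h
    ext y
    have := congrArg (fun k : G ≃g G => k y) h
    simpa using this
  · intro b hb
    refine ⟨b.trans δ.symm, ?_, ?_⟩
    · simp at hb ⊢; simp [hb]
    · ext y; simp

lemma tcount_left (δ : G ≃g G) (z x : V) : tcount G (δ z) x = tcount G z x := by
  unfold tcount
  refine Finset.card_bij (fun γ _ => δ.trans γ) ?_ ?_ ?_
  · intro γ h; simp at h ⊢; exact h
  · intro a _ b _ h
    ext y
    have := congrArg (fun k : G ≃g G => k (δ.symm y)) h
    simpa using this
  · intro b hb
    refine ⟨δ.symm.trans b, ?_, ?_⟩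
    · simp at hb ⊢; simp [hb]
    · ext y; simp

lemma wcount_left (δ : G ≃g G) (f e : Sym2 V) : wcount G f (e.map δ) = wcount G f e := by
  unfold wcount
  refine Finset.card_bij (fun γ _ => δ.trans γ) ?_ ?_ ?_
  · intro γ h; simp [Sym2.map_map] at h ⊢; exact h
  · intro a _ b _ h
    ext y
    have := congrArg (fun k : G ≃g G => k (δ.symm y)) h
    simpa using this
  · intro b hb
    refine ⟨δ.symm.trans b, ?_, ?_⟩
    · simp [Sym2.map_map] at hb ⊢
      rw [← hb]
    · ext y; simp

lemma tcount_const (htrans : ∀ u v : V, ∃ φ : G ≃g G, φ u = v) (z x z' x' : V) :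
    tcount G z x = tcount G z' x' := by
  obtain ⟨δ, rfl⟩ := htrans z z'
  obtain ⟨ε, rfl⟩ := htrans x x'
  rw [tcount_left, ← tcount_right]

lemma tcount_mul (htrans : ∀ u v : V, ∃ φ : G ≃g G, φ u = v) (z x : V) :
    Fintype.card V * tcount G z x = Fintype.card (G ≃g G) := by
  have h : Fintype.card (G ≃g G) = ∑ y : V, tcount G z y := by
    rw [← Finset.card_univ]
    exact Finset.card_eq_sum_card_fiberwise (f := fun γ : G ≃g G => γ z) (by simp)
  rw [h, Finset.sum_congr rfl (fun y _ => tcount_const htrans z y z x)]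
  simp

lemma w_le (htrans : ∀ u v : V, ∃ φ : G ≃g G, φ u = v) (f : Sym2 V) (z a x0 : V) :
    wcount G f s(z, a) ≤ 2 * tcount G x0 x0 := by
  induction f with | h x y =>
  have : wcount G s(x,y) s(z,a) ≤ tcount G z x + tcount G z y := by
    unfold wcount tcount
    refine le_trans (Finset.card_le_card ?_) (Finset.card_union_le _ _)
    intro γ; simp; tauto
  rw [tcount_const htrans z x x0 x0, tcount_const htrans z y x0 x0] at this
  omega

lemma w_le2 (htrans : ∀ u v : V, ∃ φ : G ≃g G, φ u = v) (f : Sym2 V) (z a b x0 : V)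
    (hab : a ≠ b) :
    wcount G f s(z, a) + wcount G f s(z, b) ≤ 2 * tcount G x0 x0 := by
  induction f with | h x y =>
  have : wcount G s(x,y) s(z,a) + wcount G s(x,y) s(z,b) ≤ tcount G z x + tcount G z y := by
    unfold wcount tcount
    rw [← Finset.card_union_of_disjoint]
    · refine le_trans (Finset.card_le_card ?_) (Finset.card_union_le _ _)
      intro γ; simp; tauto
    · rw [Finset.disjoint_left]
      intro γ h1 h2
      simp only [Finset.mem_filter, Finset.mem_univ, true_and] at h1 h2
      have h3 := Sym2.map.injective γ.injective (h1.trans h2.symm)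
      simp at h3
      grind
  rw [tcount_const htrans z x x0 x0, tcount_const htrans z y x0 x0] at this
  omega

lemma path_count (O : Sym2 V → Prop) [DecidablePred O] (m : V → V) (hm : ∀ z w, O s(z,w) → w = m z)
    {a b : V} (p : G.Walk a b) (hp : p.IsPath) :
    2 * (p.edges.countP O) ≤ p.length + 1 ∧
      (p.snd ≠ m a → 2 * (p.edges.countP O) ≤ p.length) := by
  induction p with
  | nil => simp
  | @cons a c b h q ih =>
    rw [Walk.cons_isPath_iff] at hp
    obtain ⟨ih1, ih2⟩ := ih hp.1
    simp only [Walk.edges_cons, Walk.length_cons, Walk.snd_cons, List.countP_cons]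
    by_cases hO : O s(a,c)
    · have h1 := hm _ _ hO
      have h2 := hm c a (by rwa [Sym2.eq_swap])
      have h3 : q.snd ≠ m c := by
        rw [← h2]; intro h4; apply hp.2; rw [← h4]; exact q.getVert_mem_support 1
      have := ih2 h3
      simp [hO, ← h1]; omega
    · simp [hO]; omega

lemma pair_bound (O : Sym2 V → Prop) [DecidablePred O] (m : V → V)
    (hm : ∀ z w, O s(z,w) → w = m z) (u : V) (D : ℕ) (P : ∀ v, G.Walk v u)
    (hP : ∀ v, (P v).IsPath) (hl : ∀ v, (P v).length = G.dist v u) (hD : ∀ v, G.dist v u ≤ D)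
    (hmm : ∀ v, m (m v) = v) (hpos : 1 ≤ D) (v : V) :
    (P v).edges.countP O + (P (m v)).edges.countP O ≤ D := by
  have key : ∀ v, D + 1 ≤ 2 * (P v).edges.countP O → 
      2 * (P v).edges.countP O ≤ D + 1 ∧ 2 * (P (m v)).edges.countP O ≤ D := by
    intro v h
    obtain ⟨h1, h2⟩ := path_count O m hm (P v) (hP v)
    obtain ⟨h3, -⟩ := path_count O m hm (P (m v)) (hP (m v))
    have h4 := hl v
    have h5 := hD v
    have h6 : (P v).snd = m v := by
      by_contra h; have := h2 h; omega
    have h7 : G.dist (m v) u ≤ (P v).tail.length := h6 ▸ dist_le _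
    have h8 : ¬ (P v).Nil := by
      rw [Walk.nil_iff_length_eq]; omega
    have h9 := Walk.length_tail_add_one h8
    have := hl (m v)
    omega
  have k1 := key v
  have k2 := key (m v)
  rw [hmm] at k2
  omega

lemma load (hconn : G.Connected) (htrans : ∀ u v : V, ∃ φ : G ≃g G, φ u = v)
    (f : Sym2 V) (hf : f ∈ G.edgeSet) (u : V) (D : ℕ) (hpos : 1 ≤ D) (P : ∀ v, G.Walk v u)
    (hP : ∀ v, (P v).IsPath) (hl : ∀ v, (P v).length = G.dist v u) (hD : ∀ v, G.dist v u ≤ D) :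
    ∑ v, ∑ e ∈ (P v).edges.toFinset, wcount G f e ≤ Fintype.card (G ≃g G) * D := by
  classical
  rw [← tcount_mul htrans u u]
  set g := tcount G u u with hg
  let O : Sym2 V → Prop := fun e => ∃ γ : G ≃g G, e.map γ = f
  set c := wcount G f f with hc
  have hO : ∀ e, O e → wcount G f e = c := by
    rintro e ⟨γ, h⟩
    rw [← wcount_left γ, h]
  have hO' : ∀ e, ¬ O e → wcount G f e = 0 := by
    intro e he
    unfold wcount
    rw [Finset.card_eq_zero, Finset.filter_eq_empty_iff]
    intro γ _ h; exact he ⟨γ, h⟩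
  have hcount : ∀ v, ∑ e ∈ (P v).edges.toFinset, wcount G f e = (P v).edges.countP O * c := by
    intro v
    have h1 : ∀ e ∈ (P v).edges.toFinset, wcount G f e = if O e then c else 0 := by
      intro e _
      split_ifs with h
      · exact hO e h
      · exact hO' e h
    rw [Finset.sum_congr rfl h1, ← Finset.sum_filter, Finset.sum_const, smul_eq_mul,
      List.countP_eq_length_filter, ← List.toFinset_card_of_nodup (l := List.filter _ _)]
    · congr 2
      ext e
      simp
    · exact ((hP v).isTrail.edges_nodup).filter _
  rw [Finset.sum_congr rfl (fun v _ => hcount v)]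
  by_cases hcg : c ≤ g
  · calc ∑ v, (P v).edges.countP O * c ≤ ∑ v : V, D * g := by
          refine Finset.sum_le_sum fun v _ => Nat.mul_le_mul ?_ hcg
          refine List.countP_le_length.trans ?_
          rw [Walk.length_edges, hl]; exact hD v
      _ = _ := by simp; ring
  · have hex : ∀ z, ∃ w, O s(z,w) := by
      intro z
      induction f with | h x y =>
      obtain ⟨γ, h⟩ := htrans z x
      exact ⟨γ.symm y, γ, by simp [h]⟩
    choose m hmO using hex
    have hm : ∀ z w, O s(z,w) → w = m z := by
      intro z w h
      by_contra hne
      have h1 := w_le2 htrans f z w (m z) u hne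
      rw [hO _ h, hO _ (hmO z)] at h1
      omega
    have hmm : ∀ v, m (m v) = v := fun v => (hm _ _ (by rw [Sym2.eq_swap]; exact hmO v)).symm
    have hc2 : c ≤ 2 * g := by
      rw [← hO _ (hmO u)]; exact w_le htrans f u _ u
    have hpair := pair_bound O m hm u D P hP hl hD hmm hpos
    have hs : 2 * ∑ v, (P v).edges.countP O ≤ Fintype.card V * D := by
      have h1 : ∑ v, (P (m v)).edges.countP O = ∑ v, (P v).edges.countP O :=
        Equiv.sum_comp (Function.Involutive.toPerm m hmm) (fun v => (P v).edges.countP O)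
      calc _ = ∑ v, ((P v).edges.countP O + (P (m v)).edges.countP O) := by
            rw [Finset.sum_add_distrib, h1]; ring
        _ ≤ ∑ v : V, D := Finset.sum_le_sum fun v _ => hpair v
        _ = _ := by simp
    rw [← Finset.sum_mul]
    calc _ ≤ (∑ v, (P v).edges.countP O) * (2 * g) := Nat.mul_le_mul_left _ hc2
      _ = (2 * ∑ v, (P v).edges.countP O) * g := by ring
      _ ≤ (Fintype.card V * D) * g := Nat.mul_le_mul_right _ hs
      _ = _ := by ring

lemma lower (htrans : ∀ u v : V, ∃ φ : G ≃g G, φ u = v) (u : V) (S : Finset V)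
    (hS : 2 * S.card ≤ Fintype.card V) :
    Fintype.card (G ≃g G) * S.card ≤
      ∑ γ : G ≃g G, ∑ v, if (γ v ∈ S ↔ γ u ∈ S) then 0 else 1 := by
  have h1 : ∀ γ : G ≃g G, (∑ v, if (γ v ∈ S ↔ γ u ∈ S) then 0 else 1) =
      if γ u ∈ S then Fintype.card V - S.card else S.card := by
    intro γ
    refine (Equiv.sum_comp γ.toEquiv (fun w => if (w ∈ S ↔ γ u ∈ S) then 0 else 1)).trans ?_
    by_cases h : γ u ∈ S
    · simp only [h, iff_true, if_true]
      rw [← Finset.card_compl]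
      simp [Finset.sum_ite, Finset.filter_not, Finset.compl_eq_univ_sdiff]
    · simp [h, Finset.sum_ite]
  rw [Finset.sum_congr rfl fun γ _ => h1 γ]
  have h2 : ∑ γ : G ≃g G, (if γ u ∈ S then Fintype.card V - S.card else S.card)
      = ∑ x : V, tcount G u u * (if x ∈ S then Fintype.card V - S.card else S.card) := by
    rw [← Finset.sum_fiberwise (s := Finset.univ) (g := fun γ : G ≃g G => γ u)]
    refine Finset.sum_congr rfl fun x _ => ?_
    rw [tcount_const htrans u u u x]
    unfold tcount
    rw [← smul_eq_mul, ← Finset.sum_const]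
    refine Finset.sum_congr rfl fun γ hγ => ?_
    simp at hγ; simp [hγ]
  rw [h2, ← Finset.mul_sum, ← tcount_mul htrans u u]
  have h3 : ∑ x : V, (if x ∈ S then Fintype.card V - S.card else S.card) =
      2 * (S.card * (Fintype.card V - S.card)) := by
    have h5 := Finset.card_compl S
    rw [Finset.sum_ite, Finset.sum_const, Finset.sum_const]
    have : (Finset.univ.filter (fun x => x ∉ S)) = Sᶜ := by ext; simp
    rw [this, h5]; simp; ring
  rw [h3]
  obtain ⟨k, hk⟩ := Nat.exists_eq_add_of_le hS
  have h4 : Fintype.card V ≤ 2 * (Fintype.card V - S.card) := by omega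
  calc _ = tcount G u u * (S.card * Fintype.card V) := by ring
    _ ≤ tcount G u u * (S.card * (2 * (Fintype.card V - S.card))) := by gcongr
    _ = _ := by ring

lemma main (hconn : G.Connected) (hcard : 2 ≤ Fintype.card V)
    (htrans : ∀ u v : V, ∃ φ : G ≃g G, φ u = v) (S : Finset V)
    (hS : 2 * S.card ≤ Fintype.card V) :
    S.card ≤ (edgeBoundary G S).card * G.diam := by
  classical
  haveI : Nontrivial V := Fintype.one_lt_card_iff_nontrivial.mp hcard
  obtain ⟨u, u', huu⟩ := exists_pair_ne V
  have hD : ∀ a b, G.dist a b ≤ G.diam := fun a b =>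
    dist_le_diam (connected_iff_ediam_ne_top.mp hconn)
  have hpos : 1 ≤ G.diam := le_trans (hconn.pos_dist_of_ne huu) (hD u u')
  have hex : ∀ v, ∃ p : G.Walk v u, p.IsPath ∧ p.length = G.dist v u :=
    fun v => hconn.exists_path_of_dist v u
  choose P hP hl using hex
  have hup : ∑ γ : G ≃g G, ∑ v, (if (γ v ∈ S ↔ γ u ∈ S) then 0 else 1) ≤
      ∑ γ : G ≃g G, ∑ v, ∑ f ∈ edgeBoundary G S, ∑ e ∈ (P v).edges.toFinset,
        if e.map γ = f then 1 else 0 := by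
    refine Finset.sum_le_sum fun γ _ => Finset.sum_le_sum fun v _ => ?_
    split_ifs with h
    · exact Nat.zero_le _
    · have hd : ∃ d ∈ (P v).darts, ¬ (γ d.fst ∈ S ↔ γ d.snd ∈ S) := by
        by_cases hv : γ v ∈ S
        · obtain ⟨d, hd, h1, h2⟩ := (P v).exists_boundary_dart {x | γ x ∈ S} hv (by simp; tauto)
          exact ⟨d, hd, by simp at h1 h2; tauto⟩
        · obtain ⟨d, hd, h1, h2⟩ := (P v).exists_boundary_dart {x | γ x ∉ S} hv (by simp; tauto)
          exact ⟨d, hd, by simp at h1 h2; tauto⟩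
      obtain ⟨d, hd, h1⟩ := hd
      have hadj : G.Adj (γ d.fst) (γ d.snd) := γ.map_adj_iff.mpr d.adj
      have hmem : d.edge.map γ ∈ edgeBoundary G S := by
        have he : d.edge.map γ = s(γ d.fst, γ d.snd) := rfl
        rw [he]
        unfold edgeBoundary
        simp only [Finset.mem_filter, mem_edgeFinset, mem_edgeSet]
        refine ⟨hadj, ?_⟩
        by_cases h2 : γ d.fst ∈ S
        · exact ⟨_, _, rfl, h2, by tauto⟩
        · exact ⟨_, _, Sym2.eq_swap, by tauto, h2⟩
      have hde : d.edge ∈ (P v).edges.toFinset := by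
        rw [List.mem_toFinset]; exact List.mem_map_of_mem hd
      calc 1 = (if d.edge.map γ = d.edge.map γ then 1 else 0) := by simp
        _ ≤ ∑ e ∈ (P v).edges.toFinset, if e.map γ = d.edge.map γ then 1 else 0 :=
            Finset.single_le_sum (f := fun e : Sym2 V => if e.map γ = d.edge.map γ then 1 else 0)
              (fun _ _ => Nat.zero_le _) hde
        _ ≤ _ := Finset.single_le_sum
              (f := fun f => ∑ e ∈ (P v).edges.toFinset, if e.map γ = f then 1 else 0)
              (fun _ _ => Nat.zero_le _) hmem
  have hswap : ∑ γ : G ≃g G, ∑ v, ∑ f ∈ edgeBoundary G S, ∑ e ∈ (P v).edges.toFinset,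
        (if e.map γ = f then 1 else 0) =
      ∑ f ∈ edgeBoundary G S, ∑ v, ∑ e ∈ (P v).edges.toFinset, wcount G f e := by
    rw [Finset.sum_comm]
    rw [Finset.sum_comm (s := edgeBoundary G S)]
    refine Finset.sum_congr rfl fun v _ => ?_
    rw [Finset.sum_comm]
    refine Finset.sum_congr rfl fun f _ => ?_
    rw [Finset.sum_comm]
    refine Finset.sum_congr rfl fun e _ => ?_
    unfold wcount
    rw [Finset.card_filter]
  have hload : ∑ f ∈ edgeBoundary G S, ∑ v, ∑ e ∈ (P v).edges.toFinset, wcount G f e ≤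
      ∑ f ∈ edgeBoundary G S, Fintype.card (G ≃g G) * G.diam := by
    refine Finset.sum_le_sum fun f hf => ?_
    refine load hconn htrans f ?_ u G.diam hpos P hP hl (fun v => hD v u)
    unfold edgeBoundary at hf
    exact mem_edgeFinset.mp (Finset.mem_filter.mp hf).1
  have hfin := (lower htrans u S hS).trans (hup.trans (hswap.le.trans hload))
  rw [Finset.sum_const, smul_eq_mul] at hfin
  have hΓ : 0 < Fintype.card (G ≃g G) := Fintype.card_pos_iff.mpr ⟨RelIso.refl _⟩
  refine Nat.le_of_mul_le_mul_left (hfin.trans (le_of_eq ?_)) hΓ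
  ring

end CheegerAux

theorem cheeger_ge_inv_diam_of_vertex_transitive
    {V : Type*} [Fintype V] [DecidableEq V]
    (G : SimpleGraph V)
    (hconn : G.Connected) (hcard : 2 ≤ Fintype.card V)
    (htrans : ∀ u v : V, ∃ φ : G ≃g G, φ u = v) :
    ∀ S : Finset V, S.Nonempty → (S.card : ℝ) ≤ (Fintype.card V : ℝ) / 2 →
      1 / (G.diam : ℝ) ≤ ((edgeBoundary G S).card : ℝ) / (S.card : ℝ) := by
  intro S hne hS
  have hS' : 2 * S.card ≤ Fintype.card V := by
    have : (2 * S.card : ℝ) ≤ Fintype.card V := by linarith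
    exact_mod_cast this
  have h := CheegerAux.main hconn hcard htrans S hS'
  have hpos : 0 < S.card := hne.card_pos
  have hD : 0 < G.diam := by
    rcases Nat.eq_zero_or_pos G.diam with h0 | h0
    · rw [h0] at h; omega
    · exact h0
  rw [div_le_div_iff₀ (by exact_mod_cast hD) (by exact_mod_cast hpos), one_mul]
  exact_mod_cast h
end
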